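/- Fix n ≥ 1 and a real ε with 0 < ε < 1/2, and consider the 2n-dimensional Klee-Minty vertices. For all bit strings B_1, B_2 ∈ {0,1}^n with B_1 not equal to the last Gray code string G_n[2^n − 1], let B_1' = S_n(B_1) = G_n[G_n^{-1}(B_1) + 1] be the Gray code successor of B_1. Then incrementing the high-order counter strictly increases the objective: v(B_1' B_2)_1 > v(B_1 B_2)_1, where B_1 B_2 denotes the concatenation of the two strings into a bit string of length 2n and v is the Klee-Minty vertex map in dimension 2n. -/

import Mathlib

/-- The `d`-bit Gray code: `grayCode d k` is the `k`-th bit string (length `d`)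
of the Gray code sequence, `G₁ = (0,1)`,
`G_{d+1}[k] = 0·G_d[k]` if `k < 2^d` and `G_{d+1}[k] = 1·G_d[2^{d+1}-1-k]` otherwise. -/
def grayCode : (d : ℕ) → ℕ → (Fin d → Bool)
  | 0, _ => fun i => i.elim0
  | d + 1, k =>
    if k < 2 ^ d then Fin.cons false (grayCode d k)
    else Fin.cons true (grayCode d (2 ^ (d + 1) - 1 - k))

/-- Helper for the Klee-Minty vertex: value of the top coordinate for a list of bits,
via the downward recursion `v_i = ε·v_{i+1}` if `b_i = 0`, `v_i = 1 - ε·v_{i+1}` if `b_i = 1`,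
with `v` of the empty list equal to `0` (so a single bit gives `0` or `1`). -/
noncomputable def kmF (ε : ℝ) : List Bool → ℝ
  | [] => 0
  | x :: l => if x = true then 1 - ε * kmF ε l else ε * kmF ε l

/-- The Klee-Minty vertex `v(b) ∈ ℝ^d` of a bit string `b ∈ {0,1}^d`:
`v(b)_{d-1} = b_{d-1}` and `v(b)_i = ε·v(b)_{i+1}` if `b_i = 0`,
`v(b)_i = 1 - ε·v(b)_{i+1}` if `b_i = 1` (0-indexed). -/
noncomputable def kmVertex (ε : ℝ) (d : ℕ) (b : Fin d → Bool) : Fin d → ℝ :=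
  fun i => kmF ε ((List.ofFn b).drop i.val)

theorem kmF_mem_Icc {ε : ℝ} (hε0 : 0 < ε) (hε1 : ε < 1 / 2) (l : List Bool) :
    kmF ε l ∈ Set.Icc (0 : ℝ) 1 := by
  induction l with
  | nil => simp [kmF]
  | cons x l ih =>
    obtain ⟨h0, h1⟩ := ih
    cases x <;> simp only [kmF, Set.mem_Icc] <;> constructor <;> norm_num <;> nlinarith

theorem kmF_ofFn_cons_append (ε : ℝ) {d : ℕ} (x : Bool) (b : Fin d → Bool) (l : List Bool) :
    kmF ε (List.ofFn (Fin.cons x b : Fin (d + 1) → Bool) ++ l) =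
      if x = true then 1 - ε * kmF ε (List.ofFn b ++ l) else ε * kmF ε (List.ofFn b ++ l) := by
  simp [List.ofFn_succ, kmF]

theorem kmF_grayCode_append_lt_succ {ε : ℝ} (hε0 : 0 < ε) (hε1 : ε < 1 / 2) (l : List Bool)
    {d k : ℕ} (hk : k + 1 < 2 ^ d) :
    kmF ε (List.ofFn (grayCode d k) ++ l) < kmF ε (List.ofFn (grayCode d (k + 1)) ++ l) := by
  induction d generalizing k with
  | zero => simp at hk
  | succ d ih =>
    have hpow : 2 ^ (d + 1) = 2 * 2 ^ d := pow_succ' 2 d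
    rcases lt_trichotomy (k + 1) (2 ^ d) with h | h | h
    · have hk' : k < 2 ^ d := by omega
      simp only [grayCode, h, hk', if_true, kmF_ofFn_cons_append]
      simpa using mul_lt_mul_of_pos_left (ih h) hε0
    · have hk' : k < 2 ^ d := by omega
      simp only [grayCode, hk', if_true, h, lt_irrefl, if_false, kmF_ofFn_cons_append]
      have h₁ := (kmF_mem_Icc hε0 hε1 (List.ofFn (grayCode d k) ++ l)).2
      have h₂ := (kmF_mem_Icc hε0 hε1
        (List.ofFn (grayCode d (2 ^ (d + 1) - 1 - 2 ^ d)) ++ l)).2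
      norm_num
      nlinarith
    · have hk' : ¬ k < 2 ^ d := by omega
      simp only [grayCode, not_lt_of_gt h, hk', if_false, kmF_ofFn_cons_append]
      have hlt := ih (k := 2 ^ (d + 1) - 1 - (k + 1)) (by omega)
      rw [show 2 ^ (d + 1) - 1 - (k + 1) + 1 = 2 ^ (d + 1) - 1 - k by omega] at hlt
      simpa using mul_lt_mul_of_pos_left hlt hε0

/-- In the `2n`-dimensional Klee-Minty cube, replacing the high-order counter `B₁`
(not the last Gray code string) by its Gray code successor `S_n(B₁) = G_n[G_n⁻¹(B₁)+1]`
strictly increases the objective, for any low-order part `B₂`. -/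
theorem kmVertex_append_graySucc_increasing (n : ℕ) (hn : 1 ≤ n) (ε : ℝ)
    (hε0 : 0 < ε) (hε1 : ε < 1 / 2) (B₁ B₂ : Fin n → Bool)
    (hB₁ : B₁ ≠ grayCode n (2 ^ n - 1))
    (k : ℕ) (hk : k < 2 ^ n) (hkB : grayCode n k = B₁) :
    kmVertex ε (n + n) (Fin.append (grayCode n (k + 1)) B₂) ⟨0, by omega⟩ >
      kmVertex ε (n + n) (Fin.append B₁ B₂) ⟨0, by omega⟩ := by
  have hk' : k + 1 < 2 ^ n := by
    have : k ≠ 2 ^ n - 1 := fun h => hB₁ (by rw [← hkB, h])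
    omega
  subst hkB
  simpa [kmVertex, List.ofFn_fin_append] using kmF_grayCode_append_lt_succ hε0 hε1 (List.ofFn B₂) hk'
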